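/- Let t₀ < T, let A₀ : [t₀,T] → ℝ^{n×n} and C₀ : [t₀,T] → ℝ^{k×n} be continuous, and let Φ : [t₀,T] → ℝ^{n×n} be differentiable with Φ(t₀) = I, Φ'(s) = Φ(s) A₀(s)ᵀ for all s, and Φ(s) invertible for every s ∈ [t₀,T]. Let G₁ := ∫_{t₀}^T Φ(s) C₀(s)ᵀ C₀(s) Φ(s)ᵀ ds and let G₁⁺ be a Moore–Penrose inverse of G₁. Suppose v ∈ ℝⁿ lies in the range of G₁, define the control u₁(s) := C₀(s) Φ(s)ᵀ G₁⁺ v, and let η : [t₀,T] → ℝⁿ be differentiable with η'(t) = -A₀(t)ᵀ η(t) - C₀(t)ᵀ u₁(t) and η(t₀) = v. Then η(T) = 0. -/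

import Mathlib

open Matrix Set intervalIntegral

theorem ContinuousOn.matrix_mul_of_entries {X l m n : Type*} [TopologicalSpace X] [Fintype m]
    {A : X → Matrix l m ℝ} {B : X → Matrix m n ℝ} {s : Set X}
    (hA : ∀ i j, ContinuousOn (fun x => A x i j) s)
    (hB : ∀ i j, ContinuousOn (fun x => B x i j) s) (i : l) (j : n) :
    ContinuousOn (fun x => (A x * B x) i j) s := by
  simp only [Matrix.mul_apply]
  exact continuousOn_finsetSum _ fun m _ => (hA i m).mul (hB m j)

theorem HasDerivWithinAt.mulVec_apply {m n : Type*} [Fintype n] {A : ℝ → Matrix m n ℝ}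
    {A' : Matrix m n ℝ} {x : ℝ → n → ℝ} {x' : n → ℝ} {s : Set ℝ} {t : ℝ} {i : m}
    (hA : ∀ j, HasDerivWithinAt (fun r => A r i j) (A' i j) s t)
    (hx : HasDerivWithinAt x x' s t) :
    HasDerivWithinAt (fun r => (A r *ᵥ x r) i) ((A' *ᵥ x t + A t *ᵥ x') i) s t := by
  have h := HasDerivWithinAt.fun_sum (u := Finset.univ) fun j _ =>
    (hA j).mul (hasDerivWithinAt_pi.1 hx j)
  simpa only [Matrix.mulVec, dotProduct, Pi.add_apply, Pi.mul_apply, Finset.sum_add_distrib]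
    using h

theorem intervalIntegral_mulVec_apply {m n : Type*} [Fintype n] {M : ℝ → Matrix m n ℝ}
    {a b : ℝ} {i : m} (hM : ∀ j, IntervalIntegrable (fun s => M s i j) MeasureTheory.volume a b)
    (w : n → ℝ) :
    ∫ s in a..b, (M s *ᵥ w) i = ∑ j, (∫ s in a..b, M s i j) * w j := by
  simp only [Matrix.mulVec, dotProduct]
  rw [intervalIntegral.integral_finsetSum fun j _ => (hM j).mul_const (w j)]
  simp only [intervalIntegral.integral_mul_const]

/-- With `Φ` the (invertible) transition matrix, `G₁` the controllability Gramian, `G₁⁺` a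
Moore–Penrose inverse of `G₁` and `v ∈ Range G₁`, the open-loop control
`u₁(s) = C₀(s)Φ(s)ᵀG₁⁺v` steers the reduced adjoint state `η` (satisfying
`η' = -A₀ᵀη - C₀ᵀu₁`, `η(t₀) = v`) to `η(T) = 0`. -/
theorem stmt_14 (n k : ℕ) (t₀ T : ℝ) (ht : t₀ < T)
    (A₀ : ℝ → Matrix (Fin n) (Fin n) ℝ)
    (C₀ : ℝ → Matrix (Fin k) (Fin n) ℝ)
    (hA₀c : ∀ i j, ContinuousOn (fun t => A₀ t i j) (Icc t₀ T))
    (hC₀c : ∀ i j, ContinuousOn (fun t => C₀ t i j) (Icc t₀ T))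
    (Φ : ℝ → Matrix (Fin n) (Fin n) ℝ)
    (hΦ0 : Φ t₀ = 1)
    (hΦ : ∀ s ∈ Icc t₀ T, ∀ i j, HasDerivWithinAt (fun r => Φ r i j)
      ((Φ s * (A₀ s)ᵀ) i j) (Icc t₀ T) s)
    (hΦinv : ∀ s ∈ Icc t₀ T, IsUnit (Φ s))
    (G₁ G₁p : Matrix (Fin n) (Fin n) ℝ)
    (hG₁ : ∀ i j, G₁ i j = ∫ s in t₀..T, (Φ s * (C₀ s)ᵀ * C₀ s * (Φ s)ᵀ) i j)
    (h1 : G₁ * G₁p * G₁ = G₁) (h2 : G₁p * G₁ * G₁p = G₁p)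
    (h3 : (G₁ * G₁p)ᵀ = G₁ * G₁p) (h4 : (G₁p * G₁)ᵀ = G₁p * G₁)
    (v : Fin n → ℝ) (hv : v ∈ Set.range G₁.mulVec)
    (η : ℝ → Fin n → ℝ)
    (hη0 : η t₀ = v)
    (hη : ∀ t ∈ Icc t₀ T, HasDerivWithinAt η
      (-((A₀ t)ᵀ *ᵥ η t) - (C₀ t)ᵀ *ᵥ (C₀ t *ᵥ ((Φ t)ᵀ *ᵥ (G₁p *ᵥ v)))) (Icc t₀ T) t) :
    η T = 0 := by
  set w := G₁p *ᵥ v with hw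
  set M : ℝ → Matrix (Fin n) (Fin n) ℝ := fun s => Φ s * (C₀ s)ᵀ * C₀ s * (Φ s)ᵀ with hM
  have hGw : G₁ *ᵥ w = v := by
    obtain ⟨z, rfl⟩ := hv
    rw [hw, Matrix.mulVec_mulVec, Matrix.mulVec_mulVec, h1]
  have hΦc : ∀ i j, ContinuousOn (fun s => Φ s i j) (Icc t₀ T) :=
    fun i j s hs => (hΦ s hs i j).continuousWithinAt
  have hMc : ∀ i j, ContinuousOn (fun s => M s i j) (Icc t₀ T) :=
    ContinuousOn.matrix_mul_of_entries
      (ContinuousOn.matrix_mul_of_entries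
        (ContinuousOn.matrix_mul_of_entries hΦc fun i j => hC₀c j i) hC₀c)
      fun i j => hΦc j i
  have hMint : ∀ i j, IntervalIntegrable (fun s => M s i j) MeasureTheory.volume t₀ T :=
    fun i j => (hMc i j).intervalIntegrable_of_Icc ht.le
  have hderiv : ∀ i, ∀ t ∈ Icc t₀ T, HasDerivWithinAt (fun s => (Φ s *ᵥ η s) i)
      (-(M t *ᵥ w) i) (Icc t₀ T) t := by
    intro i t hs
    convert HasDerivWithinAt.mulVec_apply (fun j => hΦ t hs i j) (hη t hs) using 1
    simp [hM, Matrix.mulVec_sub, Matrix.mulVec_neg, Matrix.mulVec_mulVec, Matrix.mul_assoc]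
    ring
  have hMw : ∀ i, ContinuousOn (fun s => (M s *ᵥ w) i) (Icc t₀ T) := by
    intro i
    simp only [Matrix.mulVec, dotProduct]
    exact continuousOn_finsetSum _ fun j _ => (hMc i j).mul continuousOn_const
  have hzero : Φ T *ᵥ η T = 0 := by
    ext i
    have hftc := integral_eq_sub_of_hasDeriv_right_of_le ht.le
      (fun t hs => (hderiv i t hs).continuousWithinAt)
      (fun t hs => ((hderiv i t (Ioo_subset_Icc_self hs)).hasDerivAt
        (Icc_mem_nhds hs.1 hs.2)).hasDerivWithinAt)
      ((hMw i).neg.intervalIntegrable_of_Icc ht.le)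
    have hint : ∫ s in t₀..T, (M s *ᵥ w) i = v i := by
      rw [intervalIntegral_mulVec_apply (hMint i), ← hGw]
      simp only [Matrix.mulVec, dotProduct, hG₁, hM]
    rw [intervalIntegral.integral_neg, hint, hΦ0, hη0, Matrix.one_mulVec] at hftc
    simp only [Pi.zero_apply]
    linarith
  exact Matrix.mulVec_injective_of_isUnit (hΦinv T (right_mem_Icc.2 ht.le))
    (hzero.trans (Matrix.mulVec_zero _).symm)
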